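/- Let (T₁,T₂,T₃) be an anti-commuting triple of invertible contractions on ℂ² such that at least one T_i is a normal matrix. Then there exist a complex Hilbert space K, unitary operators U₁,U₂,U₃ on K with U_iU_j = −U_jU_i for all 1 ≤ i < j ≤ 3, and a linear isometry V : ℂ² → K such that T₁^{m}T₂^{n}T₃^{r} = V* U₁^{m}U₂^{n}U₃^{r} V for all nonnegative integers m, n, r. -/

import Mathlib

open scoped Matrix

/-- The operator norm of a `2 × 2` complex matrix regarded as an operator on the
Hilbert space `ℂ²` (i.e. `EuclideanSpace ℂ (Fin 2)`, with the `ℓ²` norm). -/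
noncomputable def opNorm2 (T : Matrix (Fin 2) (Fin 2) ℂ) : ℝ :=
  ‖Matrix.toEuclideanCLM (𝕜 := ℂ) T‖

set_option linter.unusedSectionVars false
open scoped Matrix ENNReal
open MeasureTheory

noncomputable section
variable {H : Type} [NormedAddCommGroup H] [InnerProductSpace ℂ H] [CompleteSpace H]

/-- Pointwise application of an operator on `H`, as a star homomorphism. -/
def liftOp {Ω : Type} [MeasurableSpace Ω] (μ : Measure Ω) :
    (H →L[ℂ] H) →⋆ₐ[ℂ] (Lp H 2 μ →L[ℂ] Lp H 2 μ) where
  toFun N := N.compLpL 2 μ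
  map_one' := by
    ext1 f
    apply Lp.ext
    filter_upwards [ContinuousLinearMap.coeFn_compLpL (p := 2) (μ := μ) (1 : H →L[ℂ] H) f] with x hx
    rw [hx]; rfl
  map_mul' M N := by
    ext1 f
    apply Lp.ext
    filter_upwards [ContinuousLinearMap.coeFn_compLpL (p := 2) (μ := μ) (M * N) f,
      ContinuousLinearMap.coeFn_compLpL (p := 2) (μ := μ) N f,
      ContinuousLinearMap.coeFn_compLpL (p := 2) (μ := μ) M (N.compLpL 2 μ f)] with x h1 h2 h3
    rw [h1, mul_apply_eq_comp, mul_apply_eq_comp, h3, h2]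
  map_zero' := by
    have := ContinuousLinearMap.smul_compLpL (p := 2) (μ := μ) (0 : ℂ) (0 : H →L[ℂ] H)
    simpa using this
  map_add' M N := ContinuousLinearMap.add_compLpL M N
  commutes' c := by
    ext1 f
    apply Lp.ext
    filter_upwards [ContinuousLinearMap.coeFn_compLpL (p := 2) (μ := μ)
      (algebraMap ℂ (H →L[ℂ] H) c) f, Lp.coeFn_smul c f] with x hx h2
    rw [hx, Algebra.algebraMap_eq_smul_one, Algebra.algebraMap_eq_smul_one]
    simp [h2]
  map_star' N := by
    rw [ContinuousLinearMap.star_eq_adjoint, ContinuousLinearMap.star_eq_adjoint]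
    rw [ContinuousLinearMap.eq_adjoint_iff]
    intro f g
    rw [L2.inner_def, L2.inner_def]
    apply integral_congr_ae
    filter_upwards [ContinuousLinearMap.coeFn_compLpL (p := 2) (μ := μ) N g,
      ContinuousLinearMap.coeFn_compLpL (p := 2) (μ := μ) N.adjoint f] with x h1 h2
    rw [h1, h2, ContinuousLinearMap.adjoint_inner_left]

/-- Multiplication by a bounded function. -/
def mulOp (H : Type) [NormedAddCommGroup H] [InnerProductSpace ℂ H]
    {Ω : Type} [MeasurableSpace Ω] {μ : Measure Ω} (w : Ω → ℂ) (hw : MemLp w ∞ μ) :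
    Lp H 2 μ →L[ℂ] Lp H 2 μ :=
  (ContinuousLinearMap.lsmul ℂ ℂ).holderL μ ∞ 2 2 (hw.toLp w)

lemma mulOp_coe {Ω : Type} [MeasurableSpace Ω] {μ : Measure Ω} (w : Ω → ℂ) (hw : MemLp w ∞ μ)
    (f : Lp H 2 μ) : mulOp H w hw f =ᵐ[μ] fun x => w x • f x := by
  filter_upwards [ContinuousLinearMap.coeFn_holder (r := 2)
    (ContinuousLinearMap.lsmul ℂ ℂ : ℂ →L[ℂ] H →L[ℂ] H) (hw.toLp w) f, hw.coeFn_toLp] with x h1 h2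
  rw [← h2]
  exact h1

lemma mulOp_unitary {Ω : Type} [MeasurableSpace Ω] {μ : Measure Ω} (w : Ω → ℂ) (hw : MemLp w ∞ μ)
    (h1 : ∀ x, ‖w x‖ = 1) : mulOp H w hw ∈ unitary (Lp H 2 μ →L[ℂ] Lp H 2 μ) := by
  have hw' : MemLp (fun x => star (w x)) ∞ μ := hw.star
  have key : ∀ x, star (w x) * w x = 1 := fun x => by
    have := Complex.conj_mul' (w x)
    rw [h1] at this
    simpa using this
  have hst : star (mulOp H w hw) = mulOp H _ hw' := by
    symm
    rw [ContinuousLinearMap.star_eq_adjoint]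
    rw [ContinuousLinearMap.eq_adjoint_iff]
    intro f g
    rw [L2.inner_def, L2.inner_def]
    apply integral_congr_ae
    filter_upwards [mulOp_coe w hw g, mulOp_coe _ hw' f] with x h1 h2
    rw [h1, h2, inner_smul_left, inner_smul_right]
    simp
  rw [Unitary.mem_iff, hst]
  constructor
  · ext1 f
    apply Lp.ext
    filter_upwards [mulOp_coe w hw f, mulOp_coe _ hw' (mulOp H w hw f)] with x h1 h2
    rw [mul_apply_eq_comp, h2, h1, smul_smul, key, one_smul]; rfl
  · ext1 f
    apply Lp.ext
    filter_upwards [mulOp_coe _ hw' f, mulOp_coe w hw (mulOp H _ hw' f)] with x h1 h2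
    rw [mul_apply_eq_comp, h2, h1, smul_smul, mul_comm, key, one_smul]; rfl

lemma mulOp_comm {Ω : Type} [MeasurableSpace Ω] {μ : Measure Ω} (w : Ω → ℂ) (hw : MemLp w ∞ μ)
    (N : H →L[ℂ] H) : Commute (liftOp μ N) (mulOp H w hw) := by
  change _ * _ = _ * _
  ext1 f
  apply Lp.ext
  filter_upwards [mulOp_coe w hw f, mulOp_coe w hw (liftOp μ N f),
    ContinuousLinearMap.coeFn_compLpL (p := 2) (μ := μ) N f,
    ContinuousLinearMap.coeFn_compLpL (p := 2) (μ := μ) N (mulOp H w hw f)] with x h1 h2 h3 h4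
  rw [mul_apply_eq_comp, mul_apply_eq_comp, h2]
  change (N.compLpL 2 μ _) x = w x • (N.compLpL 2 μ _) x
  rw [h4, h3, h1, map_smul]

/-- constants -/
def constIso (H : Type) [NormedAddCommGroup H] [InnerProductSpace ℂ H]
    {Ω : Type} [MeasurableSpace Ω] (μ : Measure Ω) [IsProbabilityMeasure μ] :
    H →ₗᵢ[ℂ] Lp H 2 μ where
  toLinearMap := (Lp.constL 2 μ ℂ).toLinearMap
  norm_map' x := by
    change ‖Lp.const 2 μ x‖ = ‖x‖
    rw [Lp.norm_const] <;> simp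

lemma mulOp_pow_const {Ω : Type} [MeasurableSpace Ω] {μ : Measure Ω} [IsProbabilityMeasure μ]
    (w : Ω → ℂ) (hw : MemLp w ∞ μ) (h : H) (m : ℕ) :
    (mulOp H w hw ^ m) (constIso H μ h) =ᵐ[μ] fun x => w x ^ m • h := by
  induction m with
  | zero =>
    filter_upwards [Lp.coeFn_const (p := 2) (μ := μ) h] with x hx
    rw [pow_zero, pow_zero, one_smul]; exact hx
  | succ m ih =>
    filter_upwards [ih, mulOp_coe w hw ((mulOp H w hw ^ m) (constIso H μ h))] with x h1 h2
    rw [pow_succ', mul_apply_eq_comp, h2, h1, smul_smul, pow_succ']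

lemma mulOp_moment {Ω : Type} [MeasurableSpace Ω] {μ : Measure Ω} [IsProbabilityMeasure μ]
    (w : Ω → ℂ) (hw : MemLp w ∞ μ) (a : ℂ) (m : ℕ) (hm : ∫ x, w x ^ m ∂μ = a ^ m)
    (N : H →L[ℂ] H) :
    (ContinuousLinearMap.adjoint (constIso H μ).toContinuousLinearMap) ∘L
      (liftOp μ N * mulOp H w hw ^ m) ∘L (constIso H μ).toContinuousLinearMap = a ^ m • N := by
  ext1 h
  refine ext_inner_left ℂ fun k => ?_
  simp only [ContinuousLinearMap.comp_apply, ContinuousLinearMap.adjoint_inner_right]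
  rw [L2.inner_def]
  have : ∫ x, w x ^ m * inner ℂ k (N h) ∂μ = a ^ m * inner ℂ k (N h) := by
    rw [integral_mul_const, hm]
  rw [smul_apply, inner_smul_right, ← this]
  apply integral_congr_ae
  filter_upwards [mulOp_pow_const w hw h m, Lp.coeFn_const (p := 2) (μ := μ) k,
    ContinuousLinearMap.coeFn_compLpL (p := 2) (μ := μ) N
      ((mulOp H w hw ^ m) (constIso H μ h))] with x h1 h2 h3
  have e1 : ((constIso H μ).toContinuousLinearMap k) x = k := h2
  have e2 : ((liftOp μ N * mulOp H w hw ^ m) ((constIso H μ).toContinuousLinearMap h)) x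
      = w x ^ m • N h := by
    rw [mul_apply_eq_comp]
    refine h3.trans ?_
    rw [h1, map_smul]
  rw [e1, e2, inner_smul_right]

/-- a probability measure and a unimodular function with moments `a ^ m`. -/
lemma exists_moment (a : ℂ) (ha : ‖a‖ ≤ 1) : ∃ (μ : Measure ℝ) (_ : IsProbabilityMeasure μ)
    (w : ℝ → ℂ), Measurable w ∧ (∀ x, ‖w x‖ = 1) ∧ ∀ m : ℕ, ∫ x, w x ^ m ∂μ = a ^ m := by
  rcases eq_or_lt_of_le ha with h | h
  · refine ⟨Measure.dirac 0, inferInstance, fun _ => a, measurable_const, fun _ => h, fun m => ?_⟩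
    simp
  have hne : ∀ z : ℂ, ‖z‖ ≤ 1 → 1 + star a * z ≠ 0 := by
    intro z hz h0
    have h1 : star a * z = -1 := by linear_combination h0
    have h2 : ‖star a * z‖ = 1 := by rw [h1]; simp
    rw [norm_mul, norm_star] at h2
    nlinarith [norm_nonneg a, norm_nonneg z]
  let f : ℂ → ℂ := fun z => (z + a) / (1 + star a * z)
  let w : ℝ → ℂ := fun θ => f (circleMap 0 1 θ)
  let μ : Measure ℝ := (ENNReal.ofReal (2 * Real.pi))⁻¹ • volume.restrict (Set.Ioc 0 (2 * Real.pi))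
  have hpi : 0 < 2 * Real.pi := by positivity
  have hμ : IsProbabilityMeasure μ := by
    constructor
    simp only [μ, Measure.smul_apply, Measure.restrict_apply_univ, Real.volume_Ioc, sub_zero,
      smul_eq_mul]
    exact ENNReal.inv_mul_cancel (by simpa using hpi) ENNReal.ofReal_ne_top
  have hnc : ∀ θ, ‖circleMap 0 1 θ‖ = 1 := fun θ => by simp
  refine ⟨μ, hμ, w, ?_, ?_, ?_⟩
  · have : Continuous w := by
      refine Continuous.div (by fun_prop) (by fun_prop) fun θ => hne _ (hnc θ).le
    exact this.measurable
  · intro θ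
    have hz := hnc θ
    set z := circleMap 0 1 θ
    change ‖(z + a) / (1 + star a * z)‖ = 1
    have hzz : star z * z = 1 := by
      have := Complex.conj_mul' z
      rw [hz] at this
      simpa using this
    have : z + a = z * star (1 + star a * z) := by
      simp only [star_add, star_mul, star_star, star_one]
      linear_combination (-a) * hzz
    rw [norm_div, this, norm_mul, norm_star, hz, one_mul, div_self]
    exact norm_ne_zero_iff.mpr (hne z hz.le)
  · intro m
    have hd : DiffContOnCl ℂ (fun z => f z ^ m) (Metric.ball 0 |1|) := by
      apply DifferentiableOn.diffContOnCl
      rw [abs_one, closure_ball _ one_ne_zero]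
      intro z hz
      have := hne z (by simpa using hz)
      refine DifferentiableAt.differentiableWithinAt ?_
      refine DifferentiableAt.pow ?_ m
      exact DifferentiableAt.div (by fun_prop) (by fun_prop) this
    have h1 := hd.circleAverage
    rw [Real.circleAverage_def, intervalIntegral.integral_of_le hpi.le] at h1
    simp only [μ, integral_smul_measure]
    rw [ENNReal.toReal_inv, ENNReal.toReal_ofReal hpi.le]
    rw [show (∫ x in Set.Ioc 0 (2 * Real.pi), w x ^ m) = ∫ x in Set.Ioc 0 (2 * Real.pi), f (circleMap 0 1 x) ^ m from rfl, h1]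
    simp [f]

/-- Joint dilation of a family of scalars, indexed by a commutative monoid. -/
def Dilatable {A : Type} [Ring A] [StarRing A] [Algebra ℂ A] (ψ : A →⋆ₐ[ℂ] (H →L[ℂ] H))
    {G : Type} [CommMonoid G] (χ : G →* ℂ) : Prop :=
  ∃ (K : Type) (_ : NormedAddCommGroup K) (_ : InnerProductSpace ℂ K) (_ : CompleteSpace K)
    (φ : A →⋆ₐ[ℂ] (K →L[ℂ] K)) (g : G →* (K →L[ℂ] K)) (V : H →ₗᵢ[ℂ] K),
    (∀ x, g x ∈ unitary (K →L[ℂ] K)) ∧ (∀ N x, Commute (φ N) (g x)) ∧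
    ∀ N x, (ContinuousLinearMap.adjoint V.toContinuousLinearMap) ∘L
      (φ N * g x) ∘L V.toContinuousLinearMap = χ x • ψ N

lemma dilatable_unit {A : Type} [Ring A] [StarRing A] [Algebra ℂ A]
    (ψ : A →⋆ₐ[ℂ] (H →L[ℂ] H)) : Dilatable ψ (1 : Unit →* ℂ) := by
  refine ⟨H, inferInstance, inferInstance, inferInstance, ψ, 1, LinearIsometry.id, ?_, ?_, ?_⟩
  · intro x; exact one_mem _
  · intro N x; exact Commute.one_right _
  · intro N x
    ext1 h
    refine ext_inner_left ℂ fun k => ?_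
    simp [ContinuousLinearMap.adjoint_inner_right]

lemma dilatable_step {A : Type} [Ring A] [StarRing A] [Algebra ℂ A]
    (ψ : A →⋆ₐ[ℂ] (H →L[ℂ] H)) {G : Type} [CommMonoid G] (χ : G →* ℂ) (h : Dilatable ψ χ)
    (a : ℂ) (ha : ‖a‖ ≤ 1) :
    Dilatable ψ (χ.coprod (powersHom ℂ a)) := by
  obtain ⟨K, _, _, _, φ, g, V, hu, hc, hd⟩ := h
  obtain ⟨μ, _, w, hwm, hw1, hmom⟩ := exists_moment a ha
  have hw : MemLp w ∞ μ := memLp_top_of_bound hwm.aestronglyMeasurable 1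
    (Filter.Eventually.of_forall fun x => (hw1 x).le)
  have hcm : ∀ (N : K →L[ℂ] K) (n : Multiplicative ℕ),
      Commute (liftOp μ N) (powersHom _ (mulOp K w hw) n) := fun N n => by
    rw [powersHom_apply]; exact (mulOp_comm w hw N).pow_right _
  refine ⟨Lp K 2 μ, inferInstance, inferInstance, inferInstance, (liftOp μ).comp φ,
    MonoidHom.noncommCoprod ((liftOp μ : (K →L[ℂ] K) →⋆ₐ[ℂ] _).toAlgHom.toMonoidHom.comp g)
      (powersHom _ (mulOp K w hw)) (fun x n => hcm _ _), (constIso K μ).comp V, ?_, ?_, ?_⟩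
  · rintro ⟨x, n⟩
    rw [MonoidHom.noncommCoprod_apply]
    refine mul_mem ?_ ?_
    · exact Unitary.map_mem (liftOp μ) (hu x)
    · rw [powersHom_apply]; exact pow_mem (mulOp_unitary w hw hw1) _
  · rintro N ⟨x, n⟩
    rw [MonoidHom.noncommCoprod_apply]
    exact Commute.mul_right ((hc N x).map (liftOp μ)) (hcm _ _)
  · rintro N ⟨x, n⟩
    have h1 := mulOp_moment w hw a n.toAdd (hmom _) (φ N * g x)
    rw [map_mul] at h1
    have h2 : (ContinuousLinearMap.adjoint V.toContinuousLinearMap) ∘L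
        (a ^ n.toAdd • (φ N * g x)) ∘L V.toContinuousLinearMap = a ^ n.toAdd • χ x • ψ N := by
      rw [← hd]; ext; simp
    rw [← h1] at h2
    rw [MonoidHom.noncommCoprod_apply, powersHom_apply, MonoidHom.coprod_apply, powersHom_apply,
      mul_comm (χ x), mul_smul, ← h2]
    have h3 : ((constIso K μ).comp V).toContinuousLinearMap =
      (constIso K μ).toContinuousLinearMap ∘L V.toContinuousLinearMap := rfl
    rw [h3, ContinuousLinearMap.adjoint_comp]
    simp only [ContinuousLinearMap.comp_assoc, ← mul_assoc]
    rfl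

lemma offdiag_unitary {R : Type*} [Ring R] [StarRing R] (e f u v : R) (hef : star e = f)
    (he : e * e = 0) (hf : f * f = 0) (h1 : e * f + f * e = 1)
    (hu : u ∈ unitary R) (hv : v ∈ unitary R) (eu : Commute e u) (fu : Commute f u)
    (ev : Commute e v) (fv : Commute f v) : e * u + f * v ∈ unitary R := by
  have hfe : star f = e := by rw [← hef, star_star]
  have eu' : Commute e (star u) := by
    have := fu.star_star; rwa [hfe] at this
  have ev' : Commute e (star v) := by
    have := fv.star_star; rwa [hfe] at this
  have fu' : Commute f (star u) := by
    have := eu.star_star; rwa [hef] at this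
  have fv' : Commute f (star v) := by
    have := ev.star_star; rwa [hef] at this
  obtain ⟨u1, u2⟩ := Unitary.mem_iff.mp hu
  obtain ⟨v1, v2⟩ := Unitary.mem_iff.mp hv
  have hs : star (e * u + f * v) = f * star u + e * star v := by
    rw [star_add, star_mul, star_mul, hef, hfe, fu'.eq, ev'.eq]
  rw [Unitary.mem_iff, hs]
  constructor
  · calc (f * star u + e * star v) * (e * u + f * v)
        = f * (star u * e) * u + f * (star u * f) * v + e * (star v * e) * u
          + e * (star v * f) * v := by noncomm_ring
      _ = (f * e) * (star u * u) + (f * f) * (star u * v) + (e * e) * (star v * u)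
          + (e * f) * (star v * v) := by
          rw [← eu'.eq, ← fu'.eq, ← ev'.eq, ← fv'.eq]; noncomm_ring
      _ = 1 := by rw [u1, v1, he, hf, zero_mul, zero_mul, mul_one, mul_one, add_zero, add_zero, add_comm, h1]
  · calc (e * u + f * v) * (f * star u + e * star v)
        = e * (u * f) * star u + e * (u * e) * star v + f * (v * f) * star u
          + f * (v * e) * star v := by noncomm_ring
      _ = (e * f) * (u * star u) + (e * e) * (u * star v) + (f * f) * (v * star u)
          + (f * e) * (v * star v) := by
          rw [← eu.eq, ← fu.eq, ← ev.eq, ← fv.eq]; noncomm_ring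
      _ = 1 := by rw [u2, v2, he, hf, zero_mul, zero_mul, mul_one, mul_one, add_zero, add_zero, h1]

/-- Dilation property for all words. -/
def HasDil (T : Fin 3 → (H →L[ℂ] H)) : Prop :=
  ∃ (K : Type) (_ : NormedAddCommGroup K) (_ : InnerProductSpace ℂ K) (_ : CompleteSpace K)
    (U : Fin 3 → (K →L[ℂ] K)) (V : H →ₗᵢ[ℂ] K),
    (∀ i, U i ∈ unitary (K →L[ℂ] K)) ∧ (∀ i j, i ≠ j → U i * U j = -(U j * U i)) ∧
    ∀ l : List (Fin 3), (l.map T).prod =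
      (ContinuousLinearMap.adjoint V.toContinuousLinearMap) ∘L
        (l.map U).prod ∘L V.toContinuousLinearMap

lemma HasDil.perm (T : Fin 3 → (H →L[ℂ] H)) (σ : Equiv.Perm (Fin 3)) (h : HasDil (T ∘ σ)) :
    HasDil T := by
  obtain ⟨K, i1, i2, i3, U, V, hu, ha, hl⟩ := h
  refine ⟨K, i1, i2, i3, U ∘ σ.symm, V, fun i => hu _, fun i j hij => ha _ _ ?_, fun l => ?_⟩
  · simpa using hij
  · have := hl (l.map σ.symm)
    rw [List.map_map, List.map_map] at this
    rw [← this]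
    congr 2
    ext; simp

abbrev M2 := Matrix (Fin 2) (Fin 2) ℂ

/-- diag(1,-1) -/
def mZ : M2 := !![1, 0; 0, -1]
/-- upper matrix unit -/
def mE : M2 := !![0, 1; 0, 0]
/-- lower matrix unit -/
def mF : M2 := !![0, 0; 1, 0]

set_option linter.unusedSimpArgs false
lemma mZE : mZ * mE = mE := by
  ext i j; fin_cases i <;> fin_cases j <;> simp [mZ, mE, mF, Matrix.mul_apply]
lemma mEZ : mE * mZ = -mE := by
  ext i j; fin_cases i <;> fin_cases j <;> simp [mZ, mE, mF, Matrix.mul_apply]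
lemma mZF : mZ * mF = -mF := by
  ext i j; fin_cases i <;> fin_cases j <;> simp [mZ, mE, mF, Matrix.mul_apply]
lemma mFZ : mF * mZ = mF := by
  ext i j; fin_cases i <;> fin_cases j <;> simp [mZ, mE, mF, Matrix.mul_apply]
lemma mEE : mE * mE = 0 := by
  ext i j; fin_cases i <;> fin_cases j <;> simp [mZ, mE, mF, Matrix.mul_apply]
lemma mFF : mF * mF = 0 := by
  ext i j; fin_cases i <;> fin_cases j <;> simp [mZ, mE, mF, Matrix.mul_apply]
lemma mEF : mE * mF + mF * mE = 1 := by
  ext i j; fin_cases i <;> fin_cases j <;> simp [mZ, mE, mF, Matrix.mul_apply]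
lemma mE_star : star mE = mF := by
  rw [Matrix.star_eq_conjTranspose]
  ext i j; fin_cases i <;> fin_cases j <;> simp [mZ, mE, mF]
lemma mZ_unitary : mZ ∈ unitary M2 := by
  rw [Unitary.mem_iff, Matrix.star_eq_conjTranspose]
  constructor <;>
  · ext i j; fin_cases i <;> fin_cases j <;> simp [mZ, Matrix.mul_apply]

/-- The polynomial matrices. -/
def pmat {G : Type} [CommMonoid G] (w α β τ : G) : Fin 3 → MonoidAlgebra M2 G :=
  ![MonoidAlgebra.single w mZ,
    MonoidAlgebra.single α mE + MonoidAlgebra.single β mF,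
    MonoidAlgebra.single (τ * α) mE + MonoidAlgebra.single (τ * β) (-mF)]

lemma pmat_anti {G : Type} [CommMonoid G] (w α β τ : G) (i j : Fin 3) (hij : i ≠ j) :
    pmat w α β τ i * pmat w α β τ j = -(pmat w α β τ j * pmat w α β τ i) := by
  have c1 : τ * β * α = α * (τ * β) := by ac_rfl
  have c2 : β * (τ * α) = α * (τ * β) := by ac_rfl
  have c3 : τ * α * β = α * (τ * β) := by ac_rfl
  have n : ∀ (x : G) (m : M2), MonoidAlgebra.single x (-m) = -MonoidAlgebra.single x m :=
    fun x m => (MonoidAlgebra.single_neg ..)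
  fin_cases i <;> fin_cases j <;>
    first
    | exact absurd rfl hij
    | (simp [pmat, mul_add, add_mul, MonoidAlgebra.single_mul_single, mul_comm w, c1, c2, c3,
        mZE, mEZ, mZF, mFZ, mEE, mFF, -MonoidAlgebra.single_neg]; try (simp only [n]; abel))

lemma hasDil_core (ψ : M2 →⋆ₐ[ℂ] (H →L[ℂ] H)) {G : Type} [CommMonoid G] (χ : G →* ℂ)
    (h : Dilatable ψ χ) (w α β τ : G) :
    HasDil ![ψ !![χ w, 0; 0, -χ w], ψ !![0, χ α; χ β, 0],
      ψ !![0, χ τ * χ α; -(χ τ * χ β), 0]] := by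
  obtain ⟨K, i1, i2, i3, φ, g, V, hu, hc, hd⟩ := h
  let Φ : MonoidAlgebra M2 G →+* (K →L[ℂ] K) :=
    MonoidAlgebra.liftNCRingHom (φ : M2 →+* (K →L[ℂ] K)) g hc
  let χ' : G →* (H →L[ℂ] H) := (algebraMap ℂ (H →L[ℂ] H)).toMonoidHom.comp χ
  let ε : MonoidAlgebra M2 G →+* (H →L[ℂ] H) :=
    MonoidAlgebra.liftNCRingHom (ψ : M2 →+* (H →L[ℂ] H)) χ'
      (fun x y => (Algebra.commutes (χ y) (ψ x)).symm)
  have hΦ : ∀ x m, Φ (MonoidAlgebra.single x m) = φ m * g x := fun x m =>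
    MonoidAlgebra.liftNCRingHom_single ..
  have hε : ∀ x m, ε (MonoidAlgebra.single x m) = χ x • ψ m := fun x m => by
    refine (MonoidAlgebra.liftNCRingHom_single ..).trans ?_
    exact (Algebra.commutes (χ x) (ψ m)).symm.trans (Algebra.smul_def (χ x) (ψ m)).symm
  have key : ∀ p, ε p = (ContinuousLinearMap.adjoint V.toContinuousLinearMap) ∘L
        (Φ p) ∘L V.toContinuousLinearMap := by
    intro p
    induction p using MonoidAlgebra.induction_linear with
    | zero => ext; simp
    | add p q hp hq => rw [map_add, map_add, hp, hq]; ext; simp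
    | single x m => rw [hε, hΦ, hd]
  have hT : (![ψ !![χ w, 0; 0, -χ w], ψ !![0, χ α; χ β, 0],
      ψ !![0, χ τ * χ α; -(χ τ * χ β), 0]] : Fin 3 → (H →L[ℂ] H)) = ε ∘ pmat w α β τ := by
    funext i
    fin_cases i
    · change ψ !![χ w, 0; 0, -χ w] = ε (MonoidAlgebra.single w mZ)
      rw [hε, ← map_smul]; simp [mZ]
    · change ψ !![0, χ α; χ β, 0] = ε (MonoidAlgebra.single α mE + MonoidAlgebra.single β mF)
      rw [map_add, hε, hε, ← map_smul, ← map_smul, ← map_add]; simp [mE, mF]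
    · change ψ !![0, χ τ * χ α; -(χ τ * χ β), 0] =
        ε (MonoidAlgebra.single (τ * α) mE + MonoidAlgebra.single (τ * β) (-mF))
      rw [map_add, hε, hε, ← map_smul, ← map_smul, ← map_add]; simp [mE, mF]
  have hs : star (φ mE) = φ mF := by rw [← map_star, mE_star]
  have he : φ mE * φ mE = 0 := by rw [← map_mul, mEE, map_zero]
  have hf : φ mF * φ mF = 0 := by rw [← map_mul, mFF, map_zero]
  have h1 : φ mE * φ mF + φ mF * φ mE = 1 := by
    rw [← map_mul, ← map_mul, ← map_add, mEF, map_one]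
  rw [hT]
  refine ⟨K, i1, i2, i3, Φ ∘ pmat w α β τ, V, ?_, ?_, ?_⟩
  · intro i
    fin_cases i
    · change Φ (MonoidAlgebra.single w mZ) ∈ _
      rw [hΦ]
      exact mul_mem (Unitary.map_mem φ mZ_unitary) (hu _)
    · change Φ (MonoidAlgebra.single α mE + MonoidAlgebra.single β mF) ∈ _
      rw [map_add, hΦ, hΦ]
      exact offdiag_unitary _ _ _ _ hs he hf h1 (hu _) (hu _) (hc _ _) (hc _ _) (hc _ _) (hc _ _)
    · change Φ (MonoidAlgebra.single (τ * α) mE + MonoidAlgebra.single (τ * β) (-mF)) ∈ _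
      rw [map_add, hΦ, hΦ, map_neg, neg_mul, ← mul_neg]
      refine offdiag_unitary _ _ _ _ hs he hf h1 (hu _) ?_ (hc _ _) (hc _ _)
        (hc _ _).neg_right (hc _ _).neg_right
      have := hu (τ * β)
      rw [Unitary.mem_iff] at this ⊢
      simpa using this
  · intro i j hij
    simp only [Function.comp]
    rw [← map_mul, pmat_anti _ _ _ _ _ _ hij, map_neg, map_mul]
  · intro l
    rw [← List.map_map, ← List.map_map, ← map_list_prod, ← map_list_prod, key]

lemma hasDil_scalars (ψ : M2 →⋆ₐ[ℂ] (H →L[ℂ] H)) (lam a b t : ℂ) (hl : ‖lam‖ ≤ 1)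
    (ha : ‖a‖ ≤ 1) (hb : ‖b‖ ≤ 1) (ht : ‖t‖ ≤ 1) :
    HasDil ![ψ !![lam, 0; 0, -lam], ψ !![0, a; b, 0], ψ !![0, t * a; -(t * b), 0]] := by
  have := hasDil_core ψ _ (dilatable_step ψ _ (dilatable_step ψ _ (dilatable_step ψ _
    (dilatable_step ψ _ (dilatable_unit ψ) lam hl) a ha) b hb) t ht)
    ((((1, .ofAdd 1), 1), 1), 1) ((((1, 1), .ofAdd 1), 1), 1) ((((1, 1), 1), .ofAdd 1), 1)
    ((((1, 1), 1), 1), .ofAdd 1)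
  simpa [powersHom_apply] using this

lemma trace_zero {S T : M2} (hS : IsUnit S) (h : T * S = -(S * T)) : T.trace = 0 := by
  have hd : IsUnit S.det := (Matrix.isUnit_iff_isUnit_det S).mp hS
  have h1 : T = -(S * T * S⁻¹) := by
    rw [← neg_mul, ← h, mul_assoc, Matrix.mul_nonsing_inv _ hd, mul_one]
  have h2 : T.trace = -T.trace := by
    conv_lhs => rw [h1, Matrix.trace_neg, Matrix.trace_mul_comm, ← mul_assoc,
      Matrix.nonsing_inv_mul _ hd, one_mul]
  linear_combination h2 / 2

lemma entry_le (D : M2) (h : opNorm2 D ≤ 1) (i j : Fin 2) : ‖D i j‖ ≤ 1 := by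
  have h1 : (Matrix.toEuclideanCLM (𝕜 := ℂ) D (EuclideanSpace.single j 1)) i = D i j := by
    rw [Matrix.ofLp_toEuclideanCLM]
    simp
  rw [← h1]
  refine (PiLp.norm_apply_le _ i).trans ?_
  refine (ContinuousLinearMap.le_opNorm _ _).trans ?_
  have h2 : ‖EuclideanSpace.single j (1 : ℂ)‖ = 1 := by simp
  rw [h2, mul_one]
  exact h

lemma opNorm2_conj (W : M2) (hW : W ∈ unitary M2) (T : M2) (h : opNorm2 T ≤ 1) :
    opNorm2 (star W * T * W) ≤ 1 := by
  have hu : ∀ X ∈ unitary M2, opNorm2 X ≤ 1 := fun X hX => by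
    have : Matrix.toEuclideanCLM (𝕜 := ℂ) X ∈
      unitary (EuclideanSpace ℂ (Fin 2) →L[ℂ] EuclideanSpace ℂ (Fin 2)) :=
      Unitary.map_mem (Matrix.toEuclideanCLM (n := Fin 2) (𝕜 := ℂ)) hX
    exact (CStarRing.norm_of_mem_unitary this).le
  have h1 := hu _ hW
  have h2 := hu _ (Unitary.star_mem hW)
  unfold opNorm2 at *
  rw [map_mul, map_mul]
  refine (norm_mul_le _ _).trans ?_
  refine mul_le_one₀ ((norm_mul_le _ _).trans (mul_le_one₀ h2 (norm_nonneg _) h))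
    (norm_nonneg _) h1

lemma diagonalize (T : M2) (htr : T.trace = 0) (hn : T * Tᴴ = Tᴴ * T) :
    ∃ W ∈ unitary M2, ∃ lam : ℂ, star W * T * W = !![lam, 0; 0, -lam] := by
  obtain ⟨lam, hlam⟩ := IsAlgClosed.exists_pow_nat_eq (-T.det) (n := 2) (by norm_num)
  have htr' : T 1 1 = -T 0 0 := by
    rw [Matrix.trace_fin_two] at htr; linear_combination htr
  have hdet : (T - lam • (1 : M2)).det = 0 := by
    rw [Matrix.det_fin_two] at hlam ⊢
    simp
    rw [htr'] at hlam ⊢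
    linear_combination hlam
  obtain ⟨v, hv, hTv⟩ := Matrix.exists_mulVec_eq_zero_iff.mpr hdet
  have e0 : T 0 0 * v 0 + T 0 1 * v 1 = lam * v 0 := by
    have := congrFun hTv 0
    simp [Matrix.mulVec, dotProduct, Fin.sum_univ_two] at this
    linear_combination this
  have e1 : T 1 0 * v 0 + T 1 1 * v 1 = lam * v 1 := by
    have := congrFun hTv 1
    simp [Matrix.mulVec, dotProduct, Fin.sum_univ_two] at this
    linear_combination this
  have hpos : 0 < ‖v 0‖ ^ 2 + ‖v 1‖ ^ 2 := by
    by_contra hle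
    apply hv
    have h0 : ‖v 0‖ = 0 := by nlinarith [sq_nonneg ‖v 0‖, sq_nonneg ‖v 1‖]
    have h1 : ‖v 1‖ = 0 := by nlinarith [sq_nonneg ‖v 0‖, sq_nonneg ‖v 1‖]
    funext i; fin_cases i
    · simpa using h0
    · simpa using h1
  obtain ⟨n, hn0, hn2⟩ : ∃ n : ℝ, 0 < n ∧ n ^ 2 = ‖v 0‖ ^ 2 + ‖v 1‖ ^ 2 :=
    ⟨_, Real.sqrt_pos.mpr hpos, Real.sq_sqrt hpos.le⟩
  obtain ⟨x, hx⟩ : ∃ x : ℂ, x = v 0 / n := ⟨_, rfl⟩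
  obtain ⟨y, hy⟩ : ∃ y : ℂ, y = v 1 / n := ⟨_, rfl⟩
  have hnC : (n : ℂ) ≠ 0 := by exact_mod_cast hn0.ne'
  have hxy : star x * x + star y * y = 1 := by
    have c0 := Complex.conj_mul' (v 0)
    have c1 := Complex.conj_mul' (v 1)
    have c2 : (n : ℂ) ^ 2 = (‖v 0‖ : ℂ) ^ 2 + (‖v 1‖ : ℂ) ^ 2 := by exact_mod_cast hn2
    rw [hx, hy, star_div₀, star_div₀]
    simp only [RCLike.star_def, Complex.conj_ofReal]
    field_simp
    linear_combination c0 + c1 - c2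
  have f0 : T 0 0 * x + T 0 1 * y = lam * x := by
    rw [hx, hy]; field_simp; linear_combination e0
  have f1 : T 1 0 * x + T 1 1 * y = lam * y := by
    rw [hx, hy]; field_simp; linear_combination e1
  let W : M2 := !![x, -star y; y, star x]
  have hWs : star W = !![star x, star y; -y, x] := by
    rw [Matrix.star_eq_conjTranspose]
    ext i j; fin_cases i <;> fin_cases j <;> simp [W]
  have hW1 : star W * W = 1 := by
    rw [hWs]
    ext i j; fin_cases i <;> fin_cases j <;> simp [W, Matrix.mul_apply, Fin.sum_univ_two] <;>
      simp only [RCLike.star_def] at hxy <;> first | linear_combination hxy | ring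
  have hW2 : W * star W = 1 := mul_eq_one_comm.mp hW1
  refine ⟨W, Unitary.mem_iff.mpr ⟨hW1, hW2⟩, lam, ?_⟩
  obtain ⟨D, hD⟩ : ∃ D : M2, D = star W * T * W := ⟨_, rfl⟩
  have d00 : D 0 0 = lam := by
    rw [hD, hWs]
    simp [W, Matrix.mul_apply, Fin.sum_univ_two, Matrix.vecMul, dotProduct]
    simp only [RCLike.star_def] at hxy
    linear_combination (starRingEnd ℂ) x * f0 + (starRingEnd ℂ) y * f1 + lam * hxy
  have d10 : D 1 0 = 0 := by
    rw [hD, hWs]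
    simp [W, Matrix.mul_apply, Fin.sum_univ_two, Matrix.vecMul, dotProduct]
    linear_combination (-y) * f0 + x * f1
  have dtr : D 0 0 + D 1 1 = 0 := by
    rw [← Matrix.trace_fin_two, hD, Matrix.trace_mul_comm, ← mul_assoc, hW2, one_mul, htr]
  have dn : D * star D = star D * D := by
    have hs : star D = star W * star T * W := by
      rw [hD, star_mul, star_mul, star_star, mul_assoc]
    rw [hs, hD]
    calc star W * T * W * (star W * star T * W) = star W * T * (W * star W) * star T * W := by
          simp only [mul_assoc]
      _ = star W * (T * star T) * W := by rw [hW2]; simp only [mul_assoc, one_mul]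
      _ = star W * (star T * T) * W := by
          rw [Matrix.star_eq_conjTranspose, Matrix.star_eq_conjTranspose, hn]
      _ = star W * star T * (W * star W) * T * W := by rw [hW2]; simp only [mul_assoc, one_mul]
      _ = _ := by simp only [mul_assoc]
  have d01 : D 0 1 = 0 := by
    have := congrFun (congrFun dn 0) 0
    simp [Matrix.mul_apply, Fin.sum_univ_two, d10] at this
    have h2 : D 0 1 * (starRingEnd ℂ) (D 0 1) = 0 := by linear_combination this
    simpa using h2
  rw [← hD]
  ext i j; fin_cases i <;> fin_cases j
  · simpa using d00
  · simpa using d01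
  · simpa using d10
  · simp; linear_combination dtr - d00

lemma normal_first (T₁ T₂ T₃ : M2)
    (hcontr₁ : opNorm2 T₁ ≤ 1) (hcontr₂ : opNorm2 T₂ ≤ 1) (hcontr₃ : opNorm2 T₃ ≤ 1)
    (hinv₁ : IsUnit T₁) (hinv₂ : IsUnit T₂) (hinv₃ : IsUnit T₃)
    (h₁₂ : T₁ * T₂ = -(T₂ * T₁)) (h₁₃ : T₁ * T₃ = -(T₃ * T₁)) (h₂₃ : T₂ * T₃ = -(T₃ * T₂))
    (hnormal : T₁ * T₁ᴴ = T₁ᴴ * T₁) :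
    HasDil (fun i => Matrix.toEuclideanCLM (𝕜 := ℂ) (![T₁, T₂, T₃] i)) := by
  obtain ⟨W, hW, lam, hD1⟩ := diagonalize T₁ (trace_zero hinv₂ h₁₂) hnormal
  obtain ⟨hW1, hW2⟩ := Unitary.mem_iff.mp hW
  let κ : M2 ≃⋆ₐ[ℂ] M2 := Unitary.conjStarAlgAut ℂ M2 ⟨W, hW⟩
  have hκ : ∀ M, κ M = W * M * star W := fun M => by
    simp [κ, Unitary.conjStarAlgAut_apply]
  have hκ' : ∀ M, κ (star W * M * W) = M := fun M => by
    rw [hκ]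
    calc W * (star W * M * W) * star W = (W * star W) * M * (W * star W) := by
          simp only [mul_assoc]
      _ = M := by rw [hW2, one_mul, mul_one]
  let ψ : M2 →⋆ₐ[ℂ] (EuclideanSpace ℂ (Fin 2) →L[ℂ] EuclideanSpace ℂ (Fin 2)) :=
    ((Matrix.toEuclideanCLM (n := Fin 2) (𝕜 := ℂ)) : M2 →⋆ₐ[ℂ] _).comp (κ : M2 →⋆ₐ[ℂ] M2)
  have hψ : ∀ M, ψ M = Matrix.toEuclideanCLM (𝕜 := ℂ) (κ M) := fun M => rfl
  obtain ⟨D1, e1⟩ : ∃ D, D = star W * T₁ * W := ⟨_, rfl⟩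
  obtain ⟨D2, e2⟩ : ∃ D, D = star W * T₂ * W := ⟨_, rfl⟩
  obtain ⟨D3, e3⟩ : ∃ D, D = star W * T₃ * W := ⟨_, rfl⟩
  have k1 : κ D1 = T₁ := by rw [e1, hκ']
  have k2 : κ D2 = T₂ := by rw [e2, hκ']
  have k3 : κ D3 = T₃ := by rw [e3, hκ']
  have n1 := opNorm2_conj W hW T₁ hcontr₁
  have n2 := opNorm2_conj W hW T₂ hcontr₂
  have n3 := opNorm2_conj W hW T₃ hcontr₃
  rw [← e1] at n1 hD1
  rw [← e2] at n2
  rw [← e3] at n3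
  have a12 : D1 * D2 = -(D2 * D1) := EquivLike.injective κ (by
    rw [map_neg, map_mul, map_mul, k1, k2, h₁₂])
  have a13 : D1 * D3 = -(D3 * D1) := EquivLike.injective κ (by
    rw [map_neg, map_mul, map_mul, k1, k3, h₁₃])
  have a23 : D2 * D3 = -(D3 * D2) := EquivLike.injective κ (by
    rw [map_neg, map_mul, map_mul, k2, k3, h₂₃])
  have u1 : IsUnit D1 := by
    rw [← k1] at hinv₁; exact (isUnit_map_iff κ D1).mp hinv₁
  have u2 : IsUnit D2 := by
    rw [← k2] at hinv₂; exact (isUnit_map_iff κ D2).mp hinv₂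
  have u3 : IsUnit D3 := by
    rw [← k3] at hinv₃; exact (isUnit_map_iff κ D3).mp hinv₃
  have hlam : lam ≠ 0 := by
    have := ((Matrix.isUnit_iff_isUnit_det D1).mp u1).ne_zero
    rintro rfl
    rw [hD1] at this
    simp [Matrix.det_fin_two] at this
  have off : ∀ D : M2, D1 * D = -(D * D1) → D = !![0, D 0 1; D 1 0, 0] := by
    intro D h
    rw [hD1] at h
    have h0 := congrFun (congrFun h 0) 0
    have h1 := congrFun (congrFun h 1) 1
    simp [Matrix.mul_apply, Fin.sum_univ_two] at h0 h1
    have z0 : lam * D 0 0 = 0 := by linear_combination h0 / 2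
    have z1 : lam * D 1 1 = 0 := by linear_combination -h1 / 2
    ext i j; fin_cases i <;> fin_cases j
    · simpa [hlam] using z0
    · simp
    · simp
    · simpa [hlam] using z1
  have o2 := off D2 a12
  have o3 := off D3 a13
  have b2a := entry_le D2 n2 0 1
  have b2b := entry_le D2 n2 1 0
  have b3a := entry_le D3 n3 0 1
  have b3b := entry_le D3 n3 1 0
  have bl : ‖lam‖ ≤ 1 := by
    have := entry_le D1 n1 0 0
    rw [hD1] at this; simpa using this
  generalize D2 0 1 = a at *
  generalize D2 1 0 = b at *
  generalize D3 0 1 = c at *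
  generalize D3 1 0 = d at *
  have ha : a ≠ 0 := by
    have := ((Matrix.isUnit_iff_isUnit_det D2).mp u2).ne_zero
    rintro rfl
    rw [o2] at this
    simp [Matrix.det_fin_two] at this
  have hc : c ≠ 0 := by
    have := ((Matrix.isUnit_iff_isUnit_det D3).mp u3).ne_zero
    rintro rfl
    rw [o3] at this
    simp [Matrix.det_fin_two] at this
  have hrel : a * d = -(c * b) := by
    rw [o2, o3] at a23
    have := congrFun (congrFun a23 0) 0
    simpa [Matrix.mul_apply, Fin.sum_univ_two] using this
  have p1 : Matrix.toEuclideanCLM (𝕜 := ℂ) T₁ = ψ !![lam, 0; 0, -lam] := by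
    rw [hψ, ← hD1, k1]
  have p2 : Matrix.toEuclideanCLM (𝕜 := ℂ) T₂ = ψ !![0, a; b, 0] := by
    rw [hψ, ← o2, k2]
  have p3 : Matrix.toEuclideanCLM (𝕜 := ℂ) T₃ = ψ !![0, c; d, 0] := by
    rw [hψ, ← o3, k3]
  rcases le_total ‖c‖ ‖a‖ with hca | hca
  · have := hasDil_scalars ψ lam a b (c / a) bl b2a b2b (by
      rw [norm_div]; exact div_le_one_of_le₀ hca (norm_nonneg _))
    have q1 : c / a * a = c := by field_simp
    have q2 : -(c / a * b) = d := by field_simp; linear_combination -hrel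
    rw [q1, q2, ← p1, ← p2, ← p3] at this
    convert this using 1
    funext i; fin_cases i <;> rfl
  · have := hasDil_scalars ψ lam c d (a / c) bl b3a b3b (by
      rw [norm_div]; exact div_le_one_of_le₀ hca (norm_nonneg _))
    have q1 : a / c * c = a := by field_simp
    have q2 : -(a / c * d) = b := by field_simp; linear_combination -hrel
    rw [q1, q2, ← p1, ← p2, ← p3] at this
    apply HasDil.perm _ (Equiv.swap 1 2)
    convert this using 1
    funext i; fin_cases i <;> rfl

end

/-- An anti-commuting triple of invertible contractions on `ℂ²` containing a normal matrix
admits a dilation to an anti-commuting triple of unitaries. -/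
theorem stmt8 (T₁ T₂ T₃ : Matrix (Fin 2) (Fin 2) ℂ)
    (hcontr₁ : opNorm2 T₁ ≤ 1) (hcontr₂ : opNorm2 T₂ ≤ 1) (hcontr₃ : opNorm2 T₃ ≤ 1)
    (hinv₁ : IsUnit T₁) (hinv₂ : IsUnit T₂) (hinv₃ : IsUnit T₃)
    (h₁₂ : T₁ * T₂ = -(T₂ * T₁)) (h₁₃ : T₁ * T₃ = -(T₃ * T₁)) (h₂₃ : T₂ * T₃ = -(T₃ * T₂))
    (hnormal : T₁ * T₁ᴴ = T₁ᴴ * T₁ ∨ T₂ * T₂ᴴ = T₂ᴴ * T₂ ∨ T₃ * T₃ᴴ = T₃ᴴ * T₃) :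
    ∃ (K : Type) (_ : NormedAddCommGroup K) (_ : InnerProductSpace ℂ K) (_ : CompleteSpace K)
      (U₁ U₂ U₃ : K →L[ℂ] K) (V : EuclideanSpace ℂ (Fin 2) →ₗᵢ[ℂ] K),
      U₁ ∈ unitary (K →L[ℂ] K) ∧ U₂ ∈ unitary (K →L[ℂ] K) ∧ U₃ ∈ unitary (K →L[ℂ] K) ∧
      U₁ * U₂ = -(U₂ * U₁) ∧ U₁ * U₃ = -(U₃ * U₁) ∧ U₂ * U₃ = -(U₃ * U₂) ∧
      (∀ m n r : ℕ,
        Matrix.toEuclideanCLM (𝕜 := ℂ) (T₁ ^ m * T₂ ^ n * T₃ ^ r) =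
          (ContinuousLinearMap.adjoint V.toContinuousLinearMap) ∘L
            (U₁ ^ m * U₂ ^ n * U₃ ^ r) ∘L V.toContinuousLinearMap) := by
  have main : HasDil (fun i => Matrix.toEuclideanCLM (𝕜 := ℂ) (![T₁, T₂, T₃] i)) := by
    have h₂₁ : T₂ * T₁ = -(T₁ * T₂) := by rw [h₁₂, neg_neg]
    have h₃₁ : T₃ * T₁ = -(T₁ * T₃) := by rw [h₁₃, neg_neg]
    have h₃₂ : T₃ * T₂ = -(T₂ * T₃) := by rw [h₂₃, neg_neg]
    rcases hnormal with h | h | h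
    · exact normal_first T₁ T₂ T₃ hcontr₁ hcontr₂ hcontr₃ hinv₁ hinv₂ hinv₃ h₁₂ h₁₃ h₂₃ h
    · have := normal_first T₂ T₁ T₃ hcontr₂ hcontr₁ hcontr₃ hinv₂ hinv₁ hinv₃ h₂₁ h₂₃ h₁₃ h
      apply HasDil.perm _ (Equiv.swap 0 1)
      convert this using 1
      funext i; fin_cases i <;> rfl
    · have := normal_first T₃ T₂ T₁ hcontr₃ hcontr₂ hcontr₁ hinv₃ hinv₂ hinv₁ h₃₂ h₃₁ h₂₁ h
      apply HasDil.perm _ (Equiv.swap 0 2)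
      convert this using 1
      funext i; fin_cases i <;> rfl
  obtain ⟨K, i1, i2, i3, U, V, hu, ha, hl⟩ := main
  refine ⟨K, i1, i2, i3, U 0, U 1, U 2, V, hu 0, hu 1, hu 2, ha 0 1 (by decide),
    ha 0 2 (by decide), ha 1 2 (by decide), fun m n r => ?_⟩
  have := hl (List.replicate m 0 ++ List.replicate n 1 ++ List.replicate r 2)
  simp only [List.map_append, List.map_replicate, List.prod_append, List.prod_replicate] at this
  rw [← this, map_mul, map_mul, map_pow, map_pow, map_pow]
  rfl
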